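/- Let n≥2 and t>0. For any indices 0≤k,j≤n with k≠j, the mixed second partial derivative satisfies ∂²/(∂a_k ∂a_j) log I_n(t;a_0,…,a_n) ≤ 0 at every point (a_0,…,a_n)∈ℝ^{n+1}; that is, log I_n is supermodular-decreasing in off-diagonal pairs of its arguments. -/

import Mathlib

open MeasureTheory Filter

/-- The function `I_n(t; a_0,…,a_n)` of the paper:
`I_n(t;a) = e^{t a_n} ∫_{ℝ₊^n} exp{Σ_{i<n} x_i(a_i−a_n)} 1{Σ_{i<n} x_i < t} dx`. -/
noncomputable def Ifun (n : ℕ) (t : ℝ) (a : Fin (n+1) → ℝ) : ℝ :=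
  Real.exp (t * a (Fin.last n)) *
    ∫ x : Fin n → ℝ,
      Set.indicator {y : Fin n → ℝ | (∀ i, 0 ≤ y i) ∧ (∑ i, y i) < t}
        (fun y => Real.exp (∑ i, y i * (a i.castSucc - a (Fin.last n)))) x

/-- The solution `G` of `G' = b G + F`, `G 0 = 0`. -/
noncomputable def expConv (b : ℝ) (F : ℝ → ℝ) (t : ℝ) : ℝ :=
  Real.exp (b * t) * ∫ s in (0 : ℝ)..t, Real.exp (-(b * s)) * F s

theorem expConv_zero (b : ℝ) (F : ℝ → ℝ) : expConv b F 0 = 0 := by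
  simp [expConv]

theorem hasDerivAt_expConv (b : ℝ) {F : ℝ → ℝ} (hF : Continuous F) (t : ℝ) :
    HasDerivAt (expConv b F) (b * expConv b F t + F t) t := by
  have hc : Continuous fun s : ℝ => Real.exp (-(b * s)) * F s := by fun_prop
  have h1 : HasDerivAt (fun t : ℝ => ∫ s in (0 : ℝ)..t, Real.exp (-(b * s)) * F s)
      (Real.exp (-(b * t)) * F t) t := hc.integral_hasStrictDerivAt 0 t |>.hasDerivAt
  have h2 : HasDerivAt (fun t : ℝ => Real.exp (b * t)) (Real.exp (b * t) * (b * 1)) t :=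
    ((hasDerivAt_id t).const_mul b).exp
  refine (h2.mul h1).congr_deriv ?_
  have h3 : Real.exp (b * t) * Real.exp (-(b * t)) = 1 := by
    rw [← Real.exp_add]; simp
  simp only [expConv]
  linear_combination F t * h3

theorem continuous_expConv (b : ℝ) {F : ℝ → ℝ} (hF : Continuous F) :
    Continuous (expConv b F) :=
  continuous_iff_continuousAt.2 fun t => (hasDerivAt_expConv b hF t).continuousAt

theorem eq_expConv {b : ℝ} {G F : ℝ → ℝ} (hF : Continuous F)
    (hG : ∀ t, HasDerivAt G (b * G t + F t) t) (h0 : G 0 = 0) : G = expConv b F := by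
  have key : ∀ t, HasDerivAt (fun t => Real.exp (-(b * t)) * (G t - expConv b F t)) 0 t := by
    intro t
    have h2 : HasDerivAt (fun t : ℝ => Real.exp (-(b * t)))
        (Real.exp (-(b * t)) * -(b * 1)) t :=
      ((hasDerivAt_id t).const_mul b).neg.exp
    refine (h2.mul ((hG t).sub (hasDerivAt_expConv b hF t))).congr_deriv ?_
    simp only [Pi.sub_apply]
    ring
  funext t
  have h := is_const_of_deriv_eq_zero (fun t => (key t).differentiableAt)
    (fun t => (key t).deriv) t 0
  simp only [h0, expConv_zero, sub_zero, mul_zero, mul_eq_zero, Real.exp_ne_zero,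
    false_or] at h
  linarith

theorem expConv_const_mul (b c : ℝ) (F : ℝ → ℝ) (t : ℝ) :
    expConv b (fun s => c * F s) t = c * expConv b F t := by
  simp only [expConv, mul_left_comm _ c, intervalIntegral.integral_const_mul]

/-- The resolvent identity. -/
theorem sub_mul_expConv (b c : ℝ) {F : ℝ → ℝ} (hF : Continuous F) (t : ℝ) :
    (b - c) * expConv b (expConv c F) t = expConv b F t - expConv c F t := by
  rw [← expConv_const_mul]
  have hcont : Continuous fun s => (b - c) * expConv c F s :=
    continuous_const.mul (continuous_expConv c hF)
  refine (congrFun (eq_expConv (G := fun t => expConv b F t - expConv c F t)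
    hcont (fun t => ?_) ?_) t).symm
  · refine ((hasDerivAt_expConv b hF t).sub (hasDerivAt_expConv c hF t)).congr_deriv ?_
    ring
  · simp [expConv_zero]

theorem sub_mul_expConv_exp (b c t : ℝ) :
    (b - c) * expConv b (fun s => Real.exp (c * s)) t
      = Real.exp (b * t) - Real.exp (c * t) := by
  rw [← expConv_const_mul]
  refine (congrFun (eq_expConv (G := fun t => Real.exp (b * t) - Real.exp (c * t))
    (by fun_prop) (fun t => ?_) (by simp)) t).symm
  have h : ∀ d : ℝ, HasDerivAt (fun t : ℝ => Real.exp (d * t)) (Real.exp (d * t) * (d * 1)) t :=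
    fun d => ((hasDerivAt_id t).const_mul d).exp
  refine ((h b).sub (h c)).congr_deriv ?_
  ring

theorem expConv_comm (b c : ℝ) {F : ℝ → ℝ} (hF : Continuous F) :
    expConv b (expConv c F) = expConv c (expConv b F) := by
  rcases eq_or_ne b c with rfl | hbc
  · rfl
  funext t
  refine mul_left_cancel₀ (sub_ne_zero.2 hbc) ?_
  linear_combination sub_mul_expConv b c hF t + sub_mul_expConv c b hF t

theorem expConv_exp_comm (b c : ℝ) :
    expConv b (fun s => Real.exp (c * s)) = expConv c (fun s => Real.exp (b * s)) := by
  rcases eq_or_ne b c with rfl | hbc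
  · rfl
  funext t
  refine mul_left_cancel₀ (sub_ne_zero.2 hbc) ?_
  linear_combination sub_mul_expConv_exp b c t + sub_mul_expConv_exp c b t

theorem continuous_expConv_param {F : ℝ → ℝ} (hF : Continuous F) (t : ℝ) :
    Continuous fun b => expConv b F t := by
  unfold expConv
  refine Continuous.mul (by fun_prop) ?_
  exact intervalIntegral.continuous_parametric_intervalIntegral_of_continuous'
    (f := fun b s => Real.exp (-(b * s)) * F s) (by fun_prop) 0 t

theorem hasDerivAt_expConv_param {F : ℝ → ℝ} (hF : Continuous F) (b t : ℝ) :
    HasDerivAt (fun b => expConv b F t) (expConv b (expConv b F) t) b := by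
  rw [hasDerivAt_iff_tendsto_slope]
  have h := ((continuous_expConv_param (continuous_expConv b hF) t).tendsto b).mono_left
    (nhdsWithin_le_nhds (s := {b}ᶜ))
  refine h.congr' ?_
  filter_upwards [self_mem_nhdsWithin] with c hc
  have hcb : c - b ≠ 0 := sub_ne_zero.2 hc
  rw [slope_def_field, eq_div_iff hcb, mul_comm]
  exact sub_mul_expConv c b hF t

/-- Log-concavity on the positive half-line of a function that is positive there, in first order
form: `F' / F` is antitone. -/
structure IsLogConc (F F' : ℝ → ℝ) : Prop where
  hasDerivAt : ∀ t, HasDerivAt F (F' t) t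
  continuous_deriv : Continuous F'
  zero_le : 0 ≤ F 0
  pos : ∀ t, 0 < t → 0 < F t
  mul_le : ∀ s t, 0 < s → s ≤ t → F' t * F s ≤ F' s * F t

theorem IsLogConc.continuous {F F' : ℝ → ℝ} (h : IsLogConc F F') : Continuous F :=
  continuous_iff_continuousAt.2 fun t => (h.hasDerivAt t).continuousAt

theorem isLogConc_exp (c : ℝ) :
    IsLogConc (fun t => Real.exp (c * t)) (fun t => c * Real.exp (c * t)) where
  hasDerivAt t := by
    have h : HasDerivAt (fun t : ℝ => Real.exp (c * t)) (Real.exp (c * t) * (c * 1)) t :=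
      ((hasDerivAt_id t).const_mul c).exp
    exact h.congr_deriv (by ring)
  continuous_deriv := by fun_prop
  zero_le := (Real.exp_pos _).le
  pos _ _ := Real.exp_pos _
  mul_le s t _ _ := by linarith

theorem expConv_pos {F : ℝ → ℝ} (hF : Continuous F) (hpos : ∀ t, 0 < t → 0 < F t) (b : ℝ)
    {t : ℝ} (ht : 0 < t) : 0 < expConv b F t := by
  refine mul_pos (Real.exp_pos _) ?_
  refine intervalIntegral.intervalIntegral_pos_of_pos_on ?_ ?_ ht
  · exact Continuous.intervalIntegrable (by fun_prop) _ _
  · exact fun s hs => mul_pos (Real.exp_pos _) (hpos s hs.1)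

theorem IsLogConc.deriv_mul_expConv_le {F F' : ℝ → ℝ} (h : IsLogConc F F') (b : ℝ) {t : ℝ}
    (ht : 0 < t) : (F' t - b * F t) * expConv b F t ≤ F t ^ 2 := by
  have hF := h.continuous
  have hF' := h.continuous_deriv
  have e : expConv b (fun s => F' s - b * F s) t = F t - Real.exp (b * t) * F 0 := by
    refine (congrFun (eq_expConv (G := fun t => F t - Real.exp (b * t) * F 0) (by fun_prop)
      (fun t => ?_) (by simp)) t).symm
    have h1 : HasDerivAt (fun t : ℝ => Real.exp (b * t)) (Real.exp (b * t) * (b * 1)) t :=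
      ((hasDerivAt_id t).const_mul b).exp
    refine ((h.hasDerivAt t).sub (h1.mul_const (F 0))).congr_deriv ?_
    ring
  have mono : expConv b (fun s => (F' t - b * F t) * F s) t
      ≤ expConv b (fun s => F t * (F' s - b * F s)) t := by
    refine mul_le_mul_of_nonneg_left ?_ (Real.exp_pos _).le
    refine intervalIntegral.integral_mono_on_of_le_Ioo ht.le
      (Continuous.intervalIntegrable (by fun_prop) _ _)
      (Continuous.intervalIntegrable (by fun_prop) _ _) fun s hs => ?_
    refine mul_le_mul_of_nonneg_left ?_ (Real.exp_pos _).le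
    linarith [h.mul_le s t hs.1 hs.2.le]
  rw [expConv_const_mul, expConv_const_mul, e] at mono
  have := mul_nonneg (h.pos t ht).le (mul_nonneg (Real.exp_pos (b * t)).le h.zero_le)
  linarith

theorem IsLogConc.expConv {F F' : ℝ → ℝ} (h : IsLogConc F F') (b : ℝ) :
    IsLogConc (expConv b F) (fun t => b * expConv b F t + F t) where
  hasDerivAt := hasDerivAt_expConv b h.continuous
  continuous_deriv := (continuous_const.mul (continuous_expConv b h.continuous)).add h.continuous
  zero_le := (expConv_zero b F).ge
  pos _ := expConv_pos h.continuous h.pos b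
  mul_le s t hs hst := by
    have hpos : ∀ t, 0 < t → 0 < _root_.expConv b F t :=
      fun _ => expConv_pos h.continuous h.pos b
    have hd : ∀ t, 0 < t → HasDerivAt (fun t => F t / _root_.expConv b F t) _ t :=
      fun t ht => (h.hasDerivAt t).div (hasDerivAt_expConv b h.continuous t) (hpos t ht).ne'
    have anti : AntitoneOn (fun t => F t / _root_.expConv b F t) (Set.Ioi 0) := by
      refine antitoneOn_of_deriv_nonpos (convex_Ioi 0)
        (fun t ht => (hd t ht).continuousAt.continuousWithinAt)
        (fun t ht => (hd t (interior_subset ht)).differentiableAt.differentiableWithinAt)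
        fun t ht => ?_
      rw [interior_Ioi] at ht
      rw [(hd t ht).deriv]
      refine div_nonpos_of_nonpos_of_nonneg ?_ (sq_nonneg _)
      linarith [h.deriv_mul_expConv_le b ht]
    have := anti (Set.mem_Ioi.2 hs) (Set.mem_Ioi.2 (hs.trans_le hst)) hst
    rw [div_le_div_iff₀ (hpos t (hs.trans_le hst)) (hpos s hs)] at this
    linarith

/-- The iterated convolution of the exponentials `exp (c * ·)` for `c` in the list. -/
noncomputable def iterExpConv : List ℝ → ℝ → ℝ
  | [] => 0
  | [c] => fun t => Real.exp (c * t)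
  | b :: c :: l => expConv b (iterExpConv (c :: l))

theorem iterExpConv_cons (b : ℝ) {l : List ℝ} (hl : l ≠ []) :
    iterExpConv (b :: l) = expConv b (iterExpConv l) := by
  cases l with
  | nil => exact absurd rfl hl
  | cons c l => rfl

theorem exists_isLogConc_iterExpConv {l : List ℝ} (hl : l ≠ []) :
    ∃ F', IsLogConc (iterExpConv l) F' := by
  induction l with
  | nil => exact absurd rfl hl
  | cons b l ih =>
    rcases eq_or_ne l [] with rfl | hl'
    · exact ⟨_, isLogConc_exp b⟩
    · obtain ⟨F', h⟩ := ih hl'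
      rw [iterExpConv_cons b hl']
      exact ⟨_, h.expConv b⟩

theorem iterExpConv_perm {l l' : List ℝ} (h : l.Perm l') : iterExpConv l = iterExpConv l' := by
  induction h with
  | nil => rfl
  | @cons x l₁ l₂ h ih =>
    rcases eq_or_ne l₁ [] with rfl | hl
    · rw [List.nil_perm.1 h]
    · rw [iterExpConv_cons x hl, ih, iterExpConv_cons x fun h' => hl (h' ▸ h).eq_nil]
  | swap x y l =>
    rcases eq_or_ne l [] with rfl | hl
    · exact expConv_exp_comm y x
    · simp only [iterExpConv_cons _ hl, iterExpConv_cons _ (List.cons_ne_nil _ _)]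
      obtain ⟨_, h⟩ := exists_isLogConc_iterExpConv hl
      exact expConv_comm y x h.continuous
  | trans _ _ ih₁ ih₂ => exact ih₁.trans ih₂

theorem measurableSet_simplex (n : ℕ) (t : ℝ) :
    MeasurableSet {y : Fin n → ℝ | (∀ i, 0 ≤ y i) ∧ (∑ i, y i) < t} := by
  refine MeasurableSet.inter (s₁ := {y : Fin n → ℝ | ∀ i, 0 ≤ y i}) ?_ ?_
  · exact (isClosed_Ici (a := (0 : Fin n → ℝ))).measurableSet
  · exact (isOpen_lt (f := fun y : Fin n → ℝ => ∑ i, y i) (by fun_prop) continuous_const).measurableSet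

theorem integrable_simplex_indicator {n : ℕ} (t : ℝ) {f : (Fin n → ℝ) → ℝ} (hf : Continuous f) :
    Integrable (Set.indicator {y : Fin n → ℝ | (∀ i, 0 ≤ y i) ∧ (∑ i, y i) < t} f) := by
  rw [integrable_indicator_iff (measurableSet_simplex n t)]
  refine (hf.continuousOn.integrableOn_compact
    (isCompact_Icc (a := (0 : Fin n → ℝ)) (b := fun _ => t))).mono_set ?_
  rintro y ⟨h0, h1⟩
  exact ⟨h0, fun i => (Finset.single_le_sum (fun i _ => h0 i) (Finset.mem_univ i)).trans h1.le⟩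

theorem Ifun_succ (n : ℕ) (t : ℝ) (a : Fin (n + 2) → ℝ) :
    Ifun (n + 1) t a = ∫ u, Set.indicator (Set.Ico 0 t)
      (fun u => Real.exp (u * a 0) * Ifun n (t - u) (Fin.tail a)) u := by
  set L := a (Fin.last (n + 1)) with hL
  set f : (Fin (n + 1) → ℝ) → ℝ := Set.indicator
    {y : Fin (n + 1) → ℝ | (∀ i, 0 ≤ y i) ∧ (∑ i, y i) < t}
    (fun y => Real.exp (∑ i, y i * (a i.castSucc - L))) with hf
  have mp := (volume_preserving_piFinSuccAbove (fun _ : Fin (n + 1) => ℝ) 0).symm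
  have hsymm : ∀ p : ℝ × (Fin n → ℝ),
      (MeasurableEquiv.piFinSuccAbove (fun _ : Fin (n + 1) => ℝ) 0).symm p
        = Fin.cons p.1 p.2 :=
    fun p => Fin.insertNth_zero' p.1 p.2
  have hint : Integrable f := integrable_simplex_indicator t (by fun_prop)
  have e1 : ∫ x, f x = ∫ p : ℝ × (Fin n → ℝ), f (Fin.cons p.1 p.2) := by
    rw [← mp.integral_comp']
    simp only [hsymm]
  have hint2 : Integrable fun p : ℝ × (Fin n → ℝ) => f (Fin.cons p.1 p.2) :=
    (mp.integrable_comp_of_integrable hint).congr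
      (Eventually.of_forall fun p => congrArg f (hsymm p))
  have e2 : Ifun (n + 1) t a = Real.exp (t * L) * ∫ x, f x := rfl
  rw [e2, e1, Measure.volume_eq_prod, integral_prod _ hint2, ← integral_const_mul]
  refine integral_congr_ae (Eventually.of_forall fun u => ?_)
  have hlast : Fin.tail a (Fin.last n) = L := rfl
  by_cases hu : u ∈ Set.Ico 0 t
  · simp only [Set.indicator_of_mem hu, Ifun, hlast]
    have hfu : ∀ y : Fin n → ℝ, f (Fin.cons u y) = Real.exp (u * (a 0 - L)) *
        Set.indicator {y : Fin n → ℝ | (∀ i, 0 ≤ y i) ∧ (∑ i, y i) < t - u}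
        (fun y => Real.exp (∑ i, y i * (Fin.tail a i.castSucc - L))) y := by
      intro y
      have hmem : (Fin.cons u y : Fin (n + 1) → ℝ) ∈
          {y : Fin (n + 1) → ℝ | (∀ i, 0 ≤ y i) ∧ (∑ i, y i) < t} ↔
          y ∈ {y : Fin n → ℝ | (∀ i, 0 ≤ y i) ∧ (∑ i, y i) < t - u} := by
        simp only [Set.mem_ofPred_eq, Fin.forall_fin_succ, Fin.sum_univ_succ, Fin.cons_zero,
          Fin.cons_succ, hu.1, true_and, lt_sub_iff_add_lt']
      by_cases hy : y ∈ {y : Fin n → ℝ | (∀ i, 0 ≤ y i) ∧ (∑ i, y i) < t - u}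
      · rw [hf, Set.indicator_of_mem (hmem.2 hy), Set.indicator_of_mem hy, ← Real.exp_add,
          Fin.sum_univ_succ]
        rfl
      · rw [hf, Set.indicator_of_notMem (fun h => hy (hmem.1 h)), Set.indicator_of_notMem hy,
          mul_zero]
    simp only [hfu, integral_const_mul, ← mul_assoc, ← Real.exp_add]
    congr 2
    ring
  · rw [Set.indicator_of_notMem hu]
    have hfu : ∀ y : Fin n → ℝ, f (Fin.cons u y) = 0 := by
      refine fun y => Set.indicator_of_notMem (fun hy => hu ?_) _
      obtain ⟨h0, h1⟩ := hy
      have h00 := h0 0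
      rw [Fin.sum_univ_succ] at h1
      have : 0 ≤ ∑ i : Fin n, (Fin.cons u y : Fin (n + 1) → ℝ) i.succ :=
        Finset.sum_nonneg fun i _ => h0 i.succ
      rw [Fin.cons_zero] at h00 h1
      exact ⟨h00, by linarith⟩
    simp [hfu]

theorem Ifun_eq_iterExpConv (n : ℕ) {t : ℝ} (ht : 0 < t) (a : Fin (n + 1) → ℝ) :
    Ifun n t a = iterExpConv (List.ofFn a) t := by
  induction n generalizing t with
  | zero =>
    rw [Ifun, Measure.volume_pi_eq_dirac 0, integral_dirac]
    simp [iterExpConv, ht, mul_comm]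
  | succ n ih =>
    have hne : List.ofFn (Fin.tail a) ≠ [] := by simp
    have hl : List.ofFn a = a 0 :: List.ofFn (Fin.tail a) := List.ofFn_succ
    rw [hl, iterExpConv_cons _ hne, Ifun_succ]
    have h1 : ∀ u, Set.indicator (Set.Ico 0 t)
        (fun u => Real.exp (u * a 0) * Ifun n (t - u) (Fin.tail a)) u =
        Set.indicator (Set.Ico 0 t)
        (fun u => Real.exp (u * a 0) * iterExpConv (List.ofFn (Fin.tail a)) (t - u)) u := by
      intro u
      by_cases hu : u ∈ Set.Ico 0 t
      · rw [Set.indicator_of_mem hu, Set.indicator_of_mem hu, ih (sub_pos.2 hu.2)]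
      · rw [Set.indicator_of_notMem hu, Set.indicator_of_notMem hu]
    simp only [h1]
    rw [integral_indicator measurableSet_Ico, integral_Ico_eq_integral_Ioc,
      ← intervalIntegral.integral_of_le ht.le, expConv, ← intervalIntegral.integral_const_mul]
    have h2 := intervalIntegral.integral_comp_sub_left (a := 0) (b := t)
      (fun s => Real.exp (a 0 * t) *
        (Real.exp (-(a 0 * s)) * iterExpConv (List.ofFn (Fin.tail a)) s)) t
    rw [sub_self, sub_zero] at h2
    rw [← h2]
    refine intervalIntegral.integral_congr fun u _ => ?_
    simp only [← mul_assoc, ← Real.exp_add]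
    congr 2
    ring

theorem Ifun_update_update (n : ℕ) (hn : 2 ≤ n) (k j : Fin (n + 1)) (hkj : k ≠ j)
    (a : Fin (n + 1) → ℝ) :
    ∃ F F', IsLogConc F F' ∧ ∀ t, 0 < t → ∀ s r,
      Ifun n t (Function.update (Function.update a k s) j r) = expConv s (expConv r F) t := by
  set R := ((List.finRange (n + 1)).erase k).erase j with hR
  have hnd := List.nodup_finRange (n + 1)
  have hj : j ∈ (List.finRange (n + 1)).erase k := by
    rw [hnd.mem_erase_iff]
    exact ⟨hkj.symm, List.mem_finRange j⟩
  have hperm : (List.finRange (n + 1)).Perm (k :: j :: R) :=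
    (List.perm_cons_erase (List.mem_finRange k)).trans ((List.perm_cons_erase hj).cons k)
  have hRne : R.map a ≠ [] := by
    intro h
    have := hperm.length_eq
    rw [List.map_eq_nil_iff.1 h] at this
    simp at this
    omega
  obtain ⟨F', hF⟩ := exists_isLogConc_iterExpConv hRne
  refine ⟨_, F', hF, fun t ht s r => ?_⟩
  have hmap : R.map (Function.update (Function.update a k s) j r) = R.map a := by
    refine List.map_congr_left fun i hi => ?_
    rw [hR, (hnd.erase k).mem_erase_iff, hnd.mem_erase_iff] at hi
    rw [Function.update_of_ne hi.1, Function.update_of_ne hi.2.1]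
  rw [Ifun_eq_iterExpConv n ht, List.ofFn_eq_map, iterExpConv_perm (hperm.map _)]
  simp only [List.map_cons, hmap, Function.update_self, Function.update_of_ne hkj]
  rw [iterExpConv_cons _ (List.cons_ne_nil _ _), iterExpConv_cons _ hRne]

/-- Lemma `L:logmono`.  For `n ≥ 2`, `t > 0` and `k ≠ j`, the mixed
second partial derivative of `log I_n(t;·)` in the `k`-th and `j`-th variables is
nonpositive at every point `a ∈ ℝ^{n+1}`.  Partial derivatives in a coordinate are
expressed via `deriv` along `Function.update`. -/
theorem statement11 (n : ℕ) (hn : 2 ≤ n) (t : ℝ) (ht : 0 < t)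
    (k j : Fin (n+1)) (hkj : k ≠ j) (a : Fin (n+1) → ℝ) :
    deriv (fun s : ℝ =>
        deriv (fun r : ℝ =>
            Real.log (Ifun n t (Function.update (Function.update a k s) j r)))
          (a j))
      (a k) ≤ 0 := by
  obtain ⟨F, F', hF, hI⟩ := Ifun_update_update n hn k j hkj a
  simp only [hI t ht]
  generalize a k = b
  generalize a j = c
  have hcF := hF.continuous
  have hccF := continuous_expConv c hcF
  have hpos : ∀ s, 0 < expConv s (expConv c F) t :=
    fun s => ((hF.expConv c).expConv s).pos t ht
  have inner : ∀ s, deriv (fun r => Real.log (expConv s (expConv r F) t)) c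
      = expConv s (expConv c (expConv c F)) t / expConv s (expConv c F) t := by
    intro s
    have h := hasDerivAt_expConv_param (continuous_expConv s hcF) c t
    rw [expConv_comm c s hcF, expConv_comm c s hccF] at h
    simp only [fun r => expConv_comm r s hcF] at h
    exact (h.log (hpos s).ne').deriv
  simp only [inner]
  have outer := (hasDerivAt_expConv_param (continuous_expConv c hccF) b t).div
    (hasDerivAt_expConv_param hccF b t) (hpos b).ne'
  refine outer.deriv.trans_le (div_nonpos_of_nonpos_of_nonneg ?_ (sq_nonneg _))
  set K := expConv b (expConv c F) with hK
  have hKc : Continuous K := continuous_expConv b hccF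
  have e : expConv b (expConv c (expConv c F)) = expConv c K := expConv_comm b c hccF
  rw [e]
  have h1 := (((hF.expConv c).expConv b).expConv c).deriv_mul_expConv_le b ht
  have h2 := sub_mul_expConv b c hKc t
  simp only [← hK] at h1
  linear_combination h1 + expConv c K t * h2
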